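/- arXiv:2303.17929 — 2 statements merged into one kernel-verified Lean document; each statement's English description precedes it below -/
import Mathlib

section
/- Let k be a positive integer and let a₁,…,a₅ be positive integers with a₁+⋯+a₅ = 2k. Define 𝚪 = {(i,j) : i<j, a_i+a_j<k}, 𝐋 = {(i,j) : i<j, a_i+a_j>k}, 𝐇 = {(i,j) : i<j, a_i+a_j=k}, and 𝚲 = {(i,j,p,q) : i<j, i<p<q, j∉{p,q}, a_i+a_j<k, a_p+a_q<k}. Then −(1/4)·|𝚪| + (1/2)·|𝚲| + (5/4)·|𝐇| + (5/4)·|𝐋| = 5. -/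
/-- Pairs `(i,j)` with `i < j` and `a i + a j < k`, indexing the divisors `Γ_{i,j}`. -/
def GammaSet (k : ℕ) (a : Fin 5 → ℕ) : Finset (Fin 5 × Fin 5) :=
  Finset.univ.filter fun p => p.1 < p.2 ∧ a p.1 + a p.2 < k

/-- Pairs `(i,j)` with `i < j` and `a i + a j > k`, indexing the divisors `L_{i,j}`. -/
def LSet (k : ℕ) (a : Fin 5 → ℕ) : Finset (Fin 5 × Fin 5) :=
  Finset.univ.filter fun p => p.1 < p.2 ∧ k < a p.1 + a p.2

/-- Pairs `(i,j)` with `i < j` and `a i + a j = k`, indexing the horizontal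
divisors `H_{i,j}`. -/
def HSet (k : ℕ) (a : Fin 5 → ℕ) : Finset (Fin 5 × Fin 5) :=
  Finset.univ.filter fun p => p.1 < p.2 ∧ a p.1 + a p.2 = k

/-- Quadruples `(i,j,p,q)` with `i < j`, `i < p < q`, `j ∉ {p,q}`,
`a i + a j < k` and `a p + a q < k`, indexing the cherry divisors. -/
def LambdaSet (k : ℕ) (a : Fin 5 → ℕ) : Finset (Fin 5 × Fin 5 × Fin 5 × Fin 5) :=
  Finset.univ.filter fun t =>
    t.1 < t.2.1 ∧ t.1 < t.2.2.1 ∧ t.2.2.1 < t.2.2.2 ∧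
    t.2.1 ≠ t.2.2.1 ∧ t.2.1 ≠ t.2.2.2 ∧
    a t.1 + a t.2.1 < k ∧ a t.2.2.1 + a t.2.2.2 < k

/-- The unordered pairs of disjoint two-element subsets of `Fin 5`, each listed once as
`(i, j, p, q)` with `i < j`, `i < p < q` and `j ∉ {p, q}`. -/
def disjointPairs : Finset (Fin 5 × Fin 5 × Fin 5 × Fin 5) :=
  Finset.univ.filter fun t =>
    t.1 < t.2.1 ∧ t.1 < t.2.2.1 ∧ t.2.2.1 < t.2.2.2 ∧ t.2.1 ≠ t.2.2.1 ∧ t.2.1 ≠ t.2.2.2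

theorem card_disjointPairs : disjointPairs.card = 15 := by
  decide +kernel

/-- Every two-element subset of `Fin 5` is disjoint from exactly three others. -/
theorem card_disjointPairs_fiber (e : Fin 5 × Fin 5) (he : e.1 < e.2) :
    (disjointPairs.filter fun t => (t.1, t.2.1) = e).card
      + (disjointPairs.filter fun t => t.2.2 = e).card = 3 := by
  revert e
  decide +kernel

/-- Two disjoint pairs of indices cannot both have weight at least half the total. -/
theorem light_or_light {k : ℕ} {a : Fin 5 → ℕ} (ha : ∀ i, 0 < a i)
    (hsum : ∑ i, a i = 2 * k) {t : Fin 5 × Fin 5 × Fin 5 × Fin 5} (ht : t ∈ disjointPairs) :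
    a t.1 + a t.2.1 < k ∨ a t.2.2.1 + a t.2.2.2 < k := by
  obtain ⟨i, j, p, q⟩ := t
  simp only [disjointPairs, Finset.mem_filter, Finset.mem_univ, true_and] at ht
  obtain ⟨hij, hip, hpq, hjp, hjq⟩ := ht
  have hlt : ∑ x ∈ ({i, j, p, q} : Finset (Fin 5)), a x < ∑ x, a x := by
    obtain ⟨m, hm⟩ : ∃ m, m ∉ ({i, j, p, q} : Finset (Fin 5)) := by
      by_contra! h
      have h5 : Fintype.card (Fin 5) ≤ ({i, j, p, q} : Finset (Fin 5)).card :=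
        Finset.card_le_card fun x _ => h x
      exact absurd (h5.trans Finset.card_le_four) (by simp)
    exact Finset.sum_lt_sum_of_subset (Finset.subset_univ _) (Finset.mem_univ m) hm (ha m)
      fun _ _ _ => Nat.zero_le _
  rw [Finset.sum_insert (by simp [hij.ne, hip.ne, (hip.trans hpq).ne]),
    Finset.sum_insert (by simp [hjp, hjq]), Finset.sum_pair hpq.ne, hsum] at hlt
  dsimp only
  omega

theorem card_LambdaSet_add {k : ℕ} {a : Fin 5 → ℕ} (ha : ∀ i, 0 < a i)
    (hsum : ∑ i, a i = 2 * k) :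
    (LambdaSet k a).card + 15 = 3 * (GammaSet k a).card := by
  set A := disjointPairs.filter fun t => a t.1 + a t.2.1 < k with hA
  set B := disjointPairs.filter fun t => a t.2.2.1 + a t.2.2.2 < k with hB
  have hinter : A ∩ B = LambdaSet k a := by
    ext t
    simp only [hA, hB, disjointPairs, LambdaSet, Finset.mem_inter, Finset.mem_filter]
    tauto
  have hunion : A ∪ B = disjointPairs := by
    rw [hA, hB, ← Finset.filter_or]
    exact Finset.filter_true_of_mem fun t ht => light_or_light ha hsum ht
  have hAsum : A.card =
      ∑ e ∈ GammaSet k a, (disjointPairs.filter fun t => (t.1, t.2.1) = e).card := by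
    rw [Finset.card_eq_sum_card_fiberwise (f := fun t => (t.1, t.2.1)) (t := GammaSet k a)]
    · refine Finset.sum_congr rfl fun e he => congrArg Finset.card ?_
      simp only [GammaSet, Finset.mem_filter] at he
      rw [hA, Finset.filter_filter]
      refine Finset.filter_congr fun t _ => ⟨And.right, fun h => ⟨?_, h⟩⟩
      subst h
      exact he.2.2
    · intro t ht
      simp_all [disjointPairs, GammaSet]
  have hBsum : B.card = ∑ e ∈ GammaSet k a, (disjointPairs.filter fun t => t.2.2 = e).card := by
    rw [Finset.card_eq_sum_card_fiberwise (f := fun t => t.2.2) (t := GammaSet k a)]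
    · refine Finset.sum_congr rfl fun e he => congrArg Finset.card ?_
      simp only [GammaSet, Finset.mem_filter] at he
      rw [hB, Finset.filter_filter]
      refine Finset.filter_congr fun t _ => ⟨And.right, fun h => ⟨?_, h⟩⟩
      subst h
      exact he.2.2
    · intro t ht
      simp_all [disjointPairs, GammaSet]
  have hthree : A.card + B.card = 3 * (GammaSet k a).card := by
    rw [hAsum, hBsum, ← Finset.sum_add_distrib, mul_comm, ← smul_eq_mul]
    refine Finset.sum_eq_card_nsmul fun e he => card_disjointPairs_fiber e ?_
    exact (Finset.mem_filter.mp he).2.1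
  have := Finset.card_union_add_card_inter A B
  rw [hinter, hunion, card_disjointPairs] at this
  omega

theorem card_GammaSet_add_card_HSet_add_card_LSet (k : ℕ) (a : Fin 5 → ℕ) :
    (GammaSet k a).card + (HSet k a).card + (LSet k a).card = 10 := by
  have hpairs : (Finset.univ.filter fun p : Fin 5 × Fin 5 => p.1 < p.2).card = 10 := by
    decide
  rw [← hpairs, ← Finset.card_union_of_disjoint, ← Finset.card_union_of_disjoint]
  · congr 1
    ext p
    simp only [GammaSet, HSet, LSet, Finset.mem_union, Finset.mem_filter, Finset.mem_univ,
      true_and]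
    have := lt_trichotomy (a p.1 + a p.2) k
    tauto
  all_goals
    rw [Finset.disjoint_left]
    simp only [GammaSet, HSet, LSet, Finset.mem_union, Finset.mem_filter, Finset.mem_univ,
      true_and]
    omega

/-- The counting identity `-(1/4)|𝚪| + (1/2)|𝚲| + (5/4)|𝐇| + (5/4)|𝐋| = 5`. -/
theorem counting_identity (k : ℕ) (a : Fin 5 → ℕ) (hk : 0 < k)
    (ha : ∀ i, 0 < a i) (hsum : ∑ i, a i = 2 * k) :
    -(1 / 4 : ℚ) * ((GammaSet k a).card : ℚ)
      + (1 / 2 : ℚ) * ((LambdaSet k a).card : ℚ)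
      + (5 / 4 : ℚ) * ((HSet k a).card : ℚ)
      + (5 / 4 : ℚ) * ((LSet k a).card : ℚ) = 5 := by
  have hΛ : ((LambdaSet k a).card : ℚ) + 15 = 3 * (GammaSet k a).card := by
    exact_mod_cast card_LambdaSet_add ha hsum
  have htotal : ((GammaSet k a).card : ℚ) + (HSet k a).card + (LSet k a).card = 10 := by
    exact_mod_cast card_GammaSet_add_card_HSet_add_card_LSet k a
  linarith
end

section
/- Let k be a positive integer and let a₁,…,a₅ be positive integers with a₁+⋯+a₅ = 2k, and set κ_{x,y} := k − a_x − a_y. With the index sets 𝚪 = {(i,j) : i<j, a_i+a_j<k}, 𝐋 = {(i,j) : i<j, a_i+a_j>k}, and 𝚲 = {(i,j,p,q) : i<j, i<p<q, j∉{p,q}, a_i+a_j<k, a_p+a_q<k}, the following identity holds in ℚ: 1 + Σ_{(i,j)∈𝚪} ( −κ_{i,j}/k + κ_{i,j}²/k² ) + Σ_{(i,j,p,q)∈𝚲} κ_{i,j}·κ_{p,q}/k² − Σ_{(i,j)∈𝐋} κ_{i,j}²/k² = 0. -/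
/-- The `k`-enhancement `κ_{x,y} = k - a_x - a_y`, viewed as a rational number. -/
def kappa (k : ℕ) (a : Fin 5 → ℕ) (x y : Fin 5) : ℚ :=
  (k : ℚ) - (a x : ℚ) - (a y : ℚ)

/-- The ordered pairs of indices `i < j`. -/
def orderedPairs : Finset (Fin 5 × Fin 5) :=
  Finset.univ.filter fun p => p.1 < p.2

theorem orderedPairs_eq : orderedPairs =
    {(0, 1), (0, 2), (0, 3), (0, 4), (1, 2), (1, 3), (1, 4), (2, 3), (2, 4), (3, 4)} := by
  decide

theorem disjointPairs_eq : disjointPairs =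
    {(0, 1, 2, 3), (0, 1, 2, 4), (0, 1, 3, 4), (0, 2, 1, 3), (0, 2, 1, 4), (0, 2, 3, 4),
      (0, 3, 1, 2), (0, 3, 1, 4), (0, 3, 2, 4), (0, 4, 1, 2), (0, 4, 1, 3), (0, 4, 2, 3),
      (1, 2, 3, 4), (1, 3, 2, 4), (1, 4, 2, 3)} := by
  decide +kernel

theorem kappa_pos_iff (k : ℕ) (a : Fin 5 → ℕ) (x y : Fin 5) :
    0 < kappa k a x y ↔ a x + a y < k := by
  rw [kappa, sub_sub, sub_pos]
  norm_cast

theorem kappa_neg_iff (k : ℕ) (a : Fin 5 → ℕ) (x y : Fin 5) :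
    kappa k a x y < 0 ↔ k < a x + a y := by
  rw [kappa, sub_sub, sub_neg]
  norm_cast

/-- The positive part of `kappa`. -/
def kappaPos (k : ℕ) (a : Fin 5 → ℕ) (x y : Fin 5) : ℚ :=
  max (kappa k a x y) 0

theorem sum_GammaSet (k : ℕ) (a : Fin 5 → ℕ) :
    ∑ p ∈ GammaSet k a, (-(kappa k a p.1 p.2) / k + (kappa k a p.1 p.2) ^ 2 / (k : ℚ) ^ 2) =
      ∑ p ∈ orderedPairs,
        (-(kappaPos k a p.1 p.2) / k + (kappaPos k a p.1 p.2) ^ 2 / (k : ℚ) ^ 2) := by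
  rw [GammaSet, ← Finset.filter_filter, Finset.sum_filter, orderedPairs]
  refine Finset.sum_congr rfl fun p _ => ?_
  simp only [← kappa_pos_iff, kappaPos]
  split_ifs with h
  · rw [max_eq_left h.le]
  · simp [max_eq_right (not_lt.mp h)]

theorem sum_LSet (k : ℕ) (a : Fin 5 → ℕ) :
    ∑ p ∈ LSet k a, (kappa k a p.1 p.2) ^ 2 / (k : ℚ) ^ 2 =
      ∑ p ∈ orderedPairs, (kappa k a p.1 p.2 - kappaPos k a p.1 p.2) ^ 2 / (k : ℚ) ^ 2 := by
  rw [LSet, ← Finset.filter_filter, Finset.sum_filter, orderedPairs]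
  refine Finset.sum_congr rfl fun p _ => ?_
  simp only [← kappa_neg_iff, kappaPos]
  split_ifs with h
  · rw [max_eq_right h.le, sub_zero]
  · simp [max_eq_left (not_lt.mp h)]

theorem sum_LambdaSet (k : ℕ) (a : Fin 5 → ℕ) :
    ∑ t ∈ LambdaSet k a, kappa k a t.1 t.2.1 * kappa k a t.2.2.1 t.2.2.2 / (k : ℚ) ^ 2 =
      ∑ t ∈ disjointPairs,
        kappaPos k a t.1 t.2.1 * kappaPos k a t.2.2.1 t.2.2.2 / (k : ℚ) ^ 2 := by
  have hfilter : LambdaSet k a = disjointPairs.filter fun t =>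
      a t.1 + a t.2.1 < k ∧ a t.2.2.1 + a t.2.2.2 < k := by
    ext t
    simp only [LambdaSet, disjointPairs, Finset.mem_filter, Finset.mem_univ, true_and, and_assoc]
  rw [hfilter, Finset.sum_filter]
  refine Finset.sum_congr rfl fun t _ => ?_
  simp only [← kappa_pos_iff, kappaPos]
  split_ifs with h
  · rw [max_eq_left h.1.le, max_eq_left h.2.le]
  · rcases not_and_or.mp h with h | h <;> simp [max_eq_right (not_lt.mp h)]

/-- Of two disjoint pairs, at least one has `kappa` nonnegative. -/
theorem negPart_mul_negPart (k : ℕ) (a : Fin 5 → ℕ) (hsum : ∑ i, a i = 2 * k)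
    (t : Fin 5 × Fin 5 × Fin 5 × Fin 5) (ht : t ∈ disjointPairs) :
    (kappa k a t.1 t.2.1 - kappaPos k a t.1 t.2.1) *
      (kappa k a t.2.2.1 t.2.2.2 - kappaPos k a t.2.2.1 t.2.2.2) = 0 := by
  obtain ⟨x, y, z, w⟩ := t
  simp only [disjointPairs, Finset.mem_filter, Finset.mem_univ, true_and] at ht
  obtain ⟨hxy, hxz, hzw, hyz, hyw⟩ := ht
  have hle : a x + a y + a z + a w ≤ 2 * k := by
    rw [← hsum]
    calc a x + a y + a z + a w = ∑ i ∈ {x, y, z, w}, a i := by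
          rw [Finset.sum_insert, Finset.sum_insert, Finset.sum_pair hzw.ne]
          · ring
          · simp [hyz, hyw]
          · simp [hxy.ne, hxz.ne, (hxz.trans hzw).ne]
      _ ≤ ∑ i, a i := Finset.sum_le_sum_of_subset (Finset.subset_univ _)
  have hor : 0 ≤ kappa k a x y ∨ 0 ≤ kappa k a z w := by
    rw [← not_lt, ← not_lt, kappa_neg_iff, kappa_neg_iff]
    omega
  rcases hor with h | h <;> simp [kappaPos, max_eq_left h]

/-- The zero relation
`1 + Σ_{𝚪}( -κ/k + κ²/k² ) + Σ_{𝚲} κ_{i,j}κ_{p,q}/k² - Σ_{𝐋} κ²/k² = 0`. -/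
theorem zero_relation (k : ℕ) (a : Fin 5 → ℕ) (hk : 0 < k)
    (ha : ∀ i, 0 < a i) (hsum : ∑ i, a i = 2 * k) :
    1 + (∑ p ∈ GammaSet k a,
            (-(kappa k a p.1 p.2) / k + (kappa k a p.1 p.2) ^ 2 / (k : ℚ) ^ 2))
      + (∑ t ∈ LambdaSet k a,
            kappa k a t.1 t.2.1 * kappa k a t.2.2.1 t.2.2.2 / (k : ℚ) ^ 2)
      - (∑ p ∈ LSet k a, (kappa k a p.1 p.2) ^ 2 / (k : ℚ) ^ 2) = 0 := by
  have hk' : (k : ℚ) ≠ 0 := by exact_mod_cast hk.ne'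
  have hlast : (a 4 : ℚ) = 2 * k - a 0 - a 1 - a 2 - a 3 := by
    have := congrArg (Nat.cast : ℕ → ℚ) hsum
    simp only [Fin.sum_univ_five, Nat.cast_add, Nat.cast_mul, Nat.cast_ofNat] at this
    linarith
  have hprod : ∑ t ∈ disjointPairs, (kappa k a t.1 t.2.1 - kappaPos k a t.1 t.2.1) *
      (kappa k a t.2.2.1 t.2.2.2 - kappaPos k a t.2.2.1 t.2.2.2) = 0 :=
    Finset.sum_eq_zero (negPart_mul_negPart k a hsum)
  rw [sum_GammaSet, sum_LSet, sum_LambdaSet]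
  simp only [disjointPairs_eq, Fin.isValue, Finset.mem_insert, Prod.mk.injEq, Fin.reduceEq,
    and_false, and_self, and_true, zero_ne_one, Finset.mem_singleton, or_self, not_false_eq_true,
    Finset.sum_insert, Finset.sum_singleton, orderedPairs_eq] at hprod ⊢
  simp only [kappa, hlast] at hprod ⊢
  field_simp
  linear_combination hprod
end
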